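/- Let H₀ be a bounded self-adjoint operator on a complex Hilbert space 𝓗, F : 𝓗 →L[ℂ] 𝓚 a compact operator into a complex Hilbert space 𝓚, and λ ∈ ℝ. Let J be a bounded self-adjoint operator on 𝓚 with J ≥ 0 such that the direction V = F* J F is λ-regular for H₀. Then for every bounded self-adjoint operator J̃ on 𝓚 with J̃ ≥ J, the direction F* J̃ F is also λ-regular for H₀. -/

import Mathlib

open ContinuousLinearMap Filter Complex Set Topology

variable {𝓗 𝓚 : Type*} [NormedAddCommGroup 𝓗] [InnerProductSpace ℂ 𝓗] [CompleteSpace 𝓗]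
  [NormedAddCommGroup 𝓚] [InnerProductSpace ℂ 𝓚] [CompleteSpace 𝓚]

/-- `Tz F A z = F (A - z)⁻¹ F*`, using `Ring.inverse` (which is the genuine inverse when
`A - z•1` is invertible, as is the case for self-adjoint `A` and nonreal `z`). -/
noncomputable def Tz (F : 𝓗 →L[ℂ] 𝓚) (A : 𝓗 →L[ℂ] 𝓗) (z : ℂ) : 𝓚 →L[ℂ] 𝓚 :=
  F ∘L (Ring.inverse (A - z • (1 : 𝓗 →L[ℂ] 𝓗))) ∘L (adjoint F)

/-- The norm limit `T_{λ+i0}(A)` exists: there is a bounded operator `T` on `𝓚` such that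
`T_{λ+iy}(A) → T` in operator norm as `y → 0⁺`. -/
def NormLimitExists (F : 𝓗 →L[ℂ] 𝓚) (A : 𝓗 →L[ℂ] 𝓗) (lam : ℝ) : Prop :=
  ∃ T : 𝓚 →L[ℂ] 𝓚,
    Tendsto (fun y : ℝ => Tz F A ((lam : ℂ) + y * Complex.I)) (𝓝[>] 0) (𝓝 T)

/-- The direction `F* J F` is `λ`-regular for `H₀`: for some `r ∈ ℝ` the norm limit
`T_{λ+i0}(H₀ + r F* J F)` exists. -/
def IsRegularDirection (F : 𝓗 →L[ℂ] 𝓚) (H₀ : 𝓗 →L[ℂ] 𝓗) (lam : ℝ) (J : 𝓚 →L[ℂ] 𝓚) : Prop :=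
  ∃ r : ℝ, NormLimitExists F (H₀ + (r : ℂ) • ((adjoint F) ∘L J ∘L F)) lam

open InnerProductSpace in
/-- A compact operator has no infinite family of distinct eigenvalues bounded away from zero. -/
theorem aux_exists_not_eigenvalue (C : 𝓚 →L[ℂ] 𝓚) (hC : IsCompactOperator C)
    (μ : ℕ → ℂ) (hμ : Function.Injective μ) (ε : ℝ) (hε : 0 < ε) (hμε : ∀ n, ε ≤ ‖μ n‖) :
    ∃ n, ¬ Module.End.HasEigenvalue (C : Module.End ℂ 𝓚) (μ n) := by
  by_contra! hcon
  choose v hv using fun n => (hcon n).exists_hasEigenvector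
  have hli : LinearIndependent ℂ v :=
    Module.End.eigenvectors_linearIndependent' (C : Module.End ℂ 𝓚) μ hμ v hv
  have hCv : ∀ n, C (v n) = μ n • v n := fun n => (hv n).apply_eq_smul
  set e := gramSchmidtNormed ℂ v with he
  have hnorm : ∀ n, ‖e n‖ = 1 := fun n => gramSchmidtNormed_unit_length n hli
  have horth : ∀ n i, i < n → inner ℂ (e n) (v i) = 0 := by
    intro n i hi
    simp only [he, gramSchmidtNormed, inner_smul_left]
    rw [gramSchmidt_inv_triangular ℂ v hi, mul_zero]
  have hspan : ∀ n, e n ∈ Submodule.span ℂ (v '' Set.Iic n) := fun n =>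
    Submodule.smul_mem _ _ (gramSchmidt_mem_span ℂ v le_rfl)
  have hCe : ∀ n m, m < n → inner ℂ (e n) (C (e m)) = 0 := by
    intro n m hmn
    have key : ∀ x ∈ Submodule.span ℂ (v '' Set.Iic m), inner ℂ (e n) (C x) = 0 := by
      intro x hx
      induction hx using Submodule.span_induction with
      | mem x hx =>
        obtain ⟨i, hi, rfl⟩ := hx
        rw [hCv, inner_smul_right, horth n i (lt_of_le_of_lt hi hmn), mul_zero]
      | zero => simp
      | add x y _ _ hx hy => rw [map_add, inner_add_right, hx, hy, add_zero]
      | smul a x _ hx => rw [map_smul, inner_smul_right, hx, mul_zero]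
    exact key _ (hspan m)
  have hCn : ∀ n, inner ℂ (e n) (C (e n)) = μ n := by
    intro n
    have key : ∀ x ∈ Submodule.span ℂ (v '' Set.Iic n),
        inner ℂ (e n) (C x) = μ n * inner ℂ (e n) x := by
      intro x hx
      induction hx using Submodule.span_induction with
      | mem x hx =>
        obtain ⟨i, hi, rfl⟩ := hx
        rw [hCv, inner_smul_right]
        rcases (show i ≤ n from hi).lt_or_eq with h | h
        · rw [horth n i h, mul_zero, mul_zero]
        · rw [h]
      | zero => simp
      | add x y _ _ hx hy => rw [map_add, inner_add_right, hx, hy, inner_add_right, mul_add]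
      | smul a x _ hx => rw [map_smul, inner_smul_right, hx, inner_smul_right]; ring
    rw [key _ (hspan n), inner_self_eq_norm_sq_to_K, hnorm]
    simp
  have hsep : ∀ n m, m < n → ε ≤ ‖C (e n) - C (e m)‖ := by
    intro n m hmn
    have h1 : inner ℂ (e n) (C (e n) - C (e m)) = μ n := by
      rw [inner_sub_right, hCn, hCe n m hmn, sub_zero]
    calc ε ≤ ‖μ n‖ := hμε n
      _ = ‖inner ℂ (e n) (C (e n) - C (e m))‖ := by rw [h1]
      _ ≤ ‖e n‖ * ‖C (e n) - C (e m)‖ := norm_inner_le_norm _ _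
      _ = _ := by rw [hnorm, one_mul]
  obtain ⟨K, hK, hK'⟩ := hC.image_closedBall_subset_compact (1 : ℝ)
  obtain ⟨y, hyK, ψ, hψ, hψy⟩ := hK.tendsto_subseq
    (x := fun n => C (e n)) (fun n ↦ hK' ⟨e n, by simp [hnorm], rfl⟩)
  replace hψy := hψy.cauchySeq
  rw [Metric.cauchySeq_iff'] at hψy
  obtain ⟨N, hN⟩ := hψy ε hε
  have h2 := hN (N + 1) (by simp)
  rw [dist_eq_norm] at h2
  exact absurd (hsep _ _ (hψ (Nat.lt_succ_self N))) (not_le.mpr h2)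

theorem aux_pos_ker (J : 𝓚 →L[ℂ] 𝓚) (hJ : J.IsPositive) (x : 𝓚)
    (hx : (inner ℂ x (J x)).re ≤ 0) : J x = 0 := by
  obtain ⟨S, hS⟩ := CStarAlgebra.nonneg_iff_eq_star_mul_self.mp
    ((ContinuousLinearMap.nonneg_iff_isPositive J).mpr hJ)
  have h1 : J x = adjoint S (S x) := by rw [hS]; rfl
  rw [h1, adjoint_inner_right, inner_self_eq_norm_sq_to_K] at hx
  have h3 : ‖S x‖ ^ 2 ≤ 0 := by exact_mod_cast hx
  have h4 : S x = 0 := by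
    have : ‖S x‖ = 0 := by nlinarith [norm_nonneg (S x)]
    simpa using this
  rw [h1, h4, map_zero]

theorem aux_isUnit (A : 𝓗 →L[ℂ] 𝓗) (hA : IsSelfAdjoint A) (z : ℂ) (hz : z.im ≠ 0) :
    IsUnit (A - z • (1 : 𝓗 →L[ℂ] 𝓗)) := by
  by_contra h
  apply hz
  apply hA.im_eq_zero_of_mem_spectrum (z := z)
  rw [spectrum.mem_iff, Algebra.algebraMap_eq_smul_one, ← IsUnit.neg_iff, neg_sub]
  exact h

/-- Second resolvent identity. -/
theorem aux_resolvent (F : 𝓗 →L[ℂ] 𝓚) (A : 𝓗 →L[ℂ] 𝓗) (K : 𝓚 →L[ℂ] 𝓚) (z : ℂ)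
    (h1 : IsUnit (A - z • (1 : 𝓗 →L[ℂ] 𝓗)))
    (h2 : IsUnit (A + adjoint F ∘L K ∘L F - z • (1 : 𝓗 →L[ℂ] 𝓗))) :
    Tz F (A + adjoint F ∘L K ∘L F) z * (1 + K * Tz F A z) = Tz F A z := by
  unfold Tz
  set R := Ring.inverse (A - z • (1 : 𝓗 →L[ℂ] 𝓗)) with hR
  set R' := Ring.inverse (A + adjoint F ∘L K ∘L F - z • (1 : 𝓗 →L[ℂ] 𝓗)) with hR'
  have e1 := Ring.mul_inverse_cancel _ h1
  have e2 := Ring.inverse_mul_cancel _ h2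
  rw [← hR] at e1
  rw [← hR'] at e2
  have e3 : R = R' + R' * (adjoint F ∘L K ∘L F) * R := by
    calc R = R' * (A + adjoint F ∘L K ∘L F - z • (1 : 𝓗 →L[ℂ] 𝓗)) * R := by rw [e2, one_mul]
      _ = R' * ((A - z • (1 : 𝓗 →L[ℂ] 𝓗)) * R) + R' * (adjoint F ∘L K ∘L F) * R := by
        noncomm_ring
      _ = _ := by rw [e1, mul_one]
  ext x
  have e4 := congrArg (fun B : 𝓗 →L[ℂ] 𝓗 => F (B (adjoint F x))) e3
  simp only [ContinuousLinearMap.add_apply, ContinuousLinearMap.mul_apply, map_add,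
    ContinuousLinearMap.comp_apply, ContinuousLinearMap.one_apply] at e4 ⊢
  exact e4.symm

theorem aux_im_nonneg (F : 𝓗 →L[ℂ] 𝓚) (A : 𝓗 →L[ℂ] 𝓗) (hA : IsSelfAdjoint A) (z : ℂ)
    (hz : 0 < z.im) (u : 𝓚) : 0 ≤ (inner ℂ u (Tz F A z u)).im := by
  have e1 := Ring.mul_inverse_cancel _ (aux_isUnit A hA z hz.ne')
  unfold Tz
  set R := Ring.inverse (A - z • (1 : 𝓗 →L[ℂ] 𝓗)) with hR
  set x := R (adjoint F u) with hx
  have e2 : adjoint F u = A x - z • x := by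
    have := congrArg (fun B : 𝓗 →L[ℂ] 𝓗 => B (adjoint F u)) e1
    simpa using this.symm
  have e3 : inner ℂ u ((F ∘L R ∘L adjoint F) u) = inner ℂ (A x) x - (starRingEnd ℂ z) * (‖x‖ : ℂ) ^ 2 := by
    simp only [ContinuousLinearMap.comp_apply]
    rw [← hx, ← adjoint_inner_left, e2, inner_sub_left, inner_smul_left,
      inner_self_eq_norm_sq_to_K]
    rfl
  have e4 : (inner ℂ (A x) x).im = 0 := by
    have := (ContinuousLinearMap.isSelfAdjoint_iff_isSymmetric.mp hA).coe_re_inner_apply_self x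
    have h := congrArg Complex.im this
    simpa using h.symm
  rw [e3, Complex.sub_im, e4, ← Complex.ofReal_pow, Complex.im_mul_ofReal]
  simp only [Complex.conj_im]
  nlinarith [mul_nonneg hz.le (sq_nonneg ‖x‖)]

theorem aux_exists_real (T J J' : 𝓚 →L[ℂ] 𝓚) (hT : IsCompactOperator T)
    (him : ∀ u, 0 ≤ (inner ℂ u (T u)).im) (hJ : J.IsPositive) (hle : (J' - J).IsPositive)
    (r : ℝ) : ∃ s : ℝ, IsUnit (1 + ((s : ℂ) • J' - (r : ℂ) • J) * T) := by
  have hJ' : J'.IsPositive := by simpa using hle.add hJ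
  -- invertibility at `s = -i`
  have hB : IsUnit (1 + ((-Complex.I) • J' - (r : ℂ) • J) * T) := by
    set K := (-Complex.I) • J' - (r : ℂ) • J with hK
    have hKT : IsCompactOperator (K * T) := hT.clm_comp K
    rcases hKT.hasEigenvalue_or_mem_resolventSet (μ := (-1 : ℂ)) (by simp) with h | h
    · exfalso
      obtain ⟨u, hu⟩ := h.exists_hasEigenvector
      have hu1 : K (T u) = (-1 : ℂ) • u := hu.apply_eq_smul
      have hu2 : u = - K (T u) := by rw [hu1]; simp
      apply hu.2
      set w := T u with hw
      have p1 := hJ.inner_nonneg_right w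
      have p2 := hJ'.inner_nonneg_right w
      have p3 := hle.inner_nonneg_right w
      have h5 : (inner ℂ u w).im = - (inner ℂ w (J' w)).re := by
        rw [hu2, ← inner_conj_symm, inner_neg_right, hK]
        simp only [ContinuousLinearMap.sub_apply, ContinuousLinearMap.smul_apply,
          inner_sub_right, inner_smul_right]
        have q1 := (Complex.le_def.mp p1).2
        have q2 := (Complex.le_def.mp p2).2
        simp at q1 q2
        have q3 := hJ.inner_left_eq_inner_right w w
        have q4 := hJ'.inner_left_eq_inner_right w w
        simp [q3, q4, ← q1]
      have h6 := him u
      rw [← hw, h5] at h6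
      have h7 : J' w = 0 := aux_pos_ker J' hJ' w (by linarith)
      have h8 : J w = 0 := by
        apply aux_pos_ker J hJ w
        have := (Complex.le_def.mp p3).1
        simpa [inner_sub_right, h7] using this
      rw [hu2, hK]
      simp [h7, h8]
    · rw [spectrum.mem_resolventSet_iff, ← IsUnit.neg_iff] at h
      convert h using 1
      simp [Algebra.algebraMap_eq_smul_one, add_comm]
  obtain ⟨B, hB⟩ := hB
  set C : 𝓚 →L[ℂ] 𝓚 := (↑B⁻¹ : 𝓚 →L[ℂ] 𝓚) * (J' * T) with hC
  have hCc : IsCompactOperator C := (hT.clm_comp J').clm_comp (↑B⁻¹ : 𝓚 →L[ℂ] 𝓚)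
  let s : ℕ → ℝ := fun n => 1 / ((n : ℝ) + 1)
  have hs0 : ∀ n, ((s n : ℂ) + Complex.I) ≠ 0 := by
    intro n h
    have := congrArg Complex.im h
    simp at this
  obtain ⟨n, hn⟩ := aux_exists_not_eigenvalue C hCc (fun n => -((s n : ℂ) + Complex.I)⁻¹)
    (by
      intro a b hab
      have h1 := inv_injective (neg_injective hab)
      have h2 := congrArg Complex.re h1
      simp only [s, Complex.add_re, Complex.ofReal_re, Complex.I_re, add_zero, one_div] at h2
      simpa using inv_injective h2) (1 / 2) (by norm_num)
    (by
      intro n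
      rw [norm_neg, norm_inv, ← one_div]
      apply one_div_le_one_div_of_le (norm_pos_iff.mpr (hs0 n))
      refine (norm_add_le _ _).trans ?_
      have h1 : ‖((s n : ℝ) : ℂ)‖ ≤ 1 := by
        rw [Complex.norm_real, Real.norm_of_nonneg (by positivity)]
        exact div_le_one_of_le₀ (by linarith [(Nat.cast_nonneg n : (0:ℝ) ≤ n)]) (by positivity)
      rw [Complex.norm_I]
      linarith)
  refine ⟨s n, ?_⟩
  have hres := (hCc.hasEigenvalue_or_mem_resolventSet
    (neg_ne_zero.mpr (inv_ne_zero (hs0 n)))).resolve_left hn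
  rw [spectrum.mem_resolventSet_iff, Algebra.algebraMap_eq_smul_one] at hres
  set c := (s n : ℂ) + Complex.I with hc
  have h1 : (1 : 𝓚 →L[ℂ] 𝓚) + ((s n : ℂ) • J' - (r : ℂ) • J) * T
      = (B : 𝓚 →L[ℂ] 𝓚) * ((-c) • ((-c⁻¹) • (1 : 𝓚 →L[ℂ] 𝓚) - C)) := by
    have h2 : (-c) • ((-c⁻¹) • (1 : 𝓚 →L[ℂ] 𝓚) - C) = 1 + c • C := by
      rw [smul_sub, smul_smul, neg_mul_neg, mul_inv_cancel₀ (hs0 n), one_smul, neg_smul,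
        sub_neg_eq_add]
    rw [h2, mul_add, mul_one, mul_smul_comm, hC, Units.mul_inv_cancel_left, hB, hc]
    simp only [sub_mul, smul_mul_assoc]
    module
  rw [h1]
  exact B.isUnit.mul ((isUnit_smul_iff (Units.mk0 (-c) (neg_ne_zero.mpr (hs0 n))) _).mpr hres)

/-- If `J ≥ 0` and the direction `F* J F` is `λ`-regular for `H₀`, then for any
self-adjoint `J̃ ≥ J` the direction `F* J̃ F` is also `λ`-regular for `H₀`. -/
theorem regular_of_ge_of_regular
    (H₀ : 𝓗 →L[ℂ] 𝓗) (hH₀ : IsSelfAdjoint H₀)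
    (F : 𝓗 →L[ℂ] 𝓚) (hF : IsCompactOperator F) (lam : ℝ)
    (J : 𝓚 →L[ℂ] 𝓚) (hJ : J.IsPositive)
    (hreg : IsRegularDirection F H₀ lam J)
    (J' : 𝓚 →L[ℂ] 𝓚) (hJ' : IsSelfAdjoint J') (hle : (J' - J).IsPositive) :
    IsRegularDirection F H₀ lam J' := by
  obtain ⟨r, T, hT⟩ := hreg
  set A := H₀ + (r : ℂ) • ((adjoint F) ∘L J ∘L F) with hAdef
  have hsa : ∀ (a : ℝ) (L : 𝓚 →L[ℂ] 𝓚), IsSelfAdjoint L →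
      IsSelfAdjoint (H₀ + (a : ℂ) • ((adjoint F) ∘L L ∘L F)) := by
    intro a L hL
    refine hH₀.add (IsSelfAdjoint.smul (by simp [IsSelfAdjoint]) (hL.adjoint_conj F))
  have hA : IsSelfAdjoint A := hsa r J hJ.isSelfAdjoint
  have hTc : IsCompactOperator T := isCompactOperator_of_tendsto hT
    (Eventually.of_forall fun y => hF.comp_clm _)
  have him : ∀ u, 0 ≤ (inner ℂ u (T u)).im := by
    intro u
    have hcont : Continuous fun B : 𝓚 →L[ℂ] 𝓚 => (inner ℂ u (B u)).im := by fun_prop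
    refine ge_of_tendsto ((hcont.tendsto T).comp hT) ?_
    filter_upwards [self_mem_nhdsWithin] with y hy
    exact aux_im_nonneg F A hA _ (by simpa using hy) u
  obtain ⟨s, hs⟩ := aux_exists_real T J J' hTc him hJ hle r
  set K := (s : ℂ) • J' - (r : ℂ) • J with hK
  have hA' : H₀ + (s : ℂ) • ((adjoint F) ∘L J' ∘L F) = A + adjoint F ∘L K ∘L F := by
    rw [hAdef, hK]
    ext x
    simp
  have hsa' : IsSelfAdjoint (A + adjoint F ∘L K ∘L F) := hA' ▸ hsa s J' hJ'
  refine ⟨s, T * Ring.inverse (1 + K * T), ?_⟩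
  rw [hA']
  have hlim : Tendsto (fun y : ℝ => 1 + K * Tz F A ((lam : ℂ) + y * Complex.I)) (𝓝[>] 0)
      (𝓝 (1 + K * T)) := tendsto_const_nhds.add (tendsto_const_nhds.mul hT)
  have hinv : Tendsto Ring.inverse (𝓝 (1 + K * T)) (𝓝 (Ring.inverse (1 + K * T))) := by
    obtain ⟨U, hU⟩ := hs
    rw [← hU]
    exact NormedRing.inverse_continuousAt U
  refine (hT.mul (hinv.comp hlim)).congr' ?_
  filter_upwards [self_mem_nhdsWithin, hlim.eventually (Units.isOpen.mem_nhds hs)] with y hy hu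
  have hz : ((lam : ℂ) + y * Complex.I).im ≠ 0 := by
    simpa using (ne_of_gt (show (0 : ℝ) < y from hy))
  have h := aux_resolvent F A K _ (aux_isUnit A hA _ hz) (aux_isUnit _ hsa' _ hz)
  simp only [Function.comp_apply]
  nth_rewrite 1 [← h]
  rw [mul_assoc, Ring.mul_inverse_cancel _ hu, mul_one]
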